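/- Let ℓ be a multiple of 100, L ≥ 1 an integer, and x_* ∈ E. Suppose A_1, A_2 are connected subsets of the closure of B(x_*, 3ℓL), each of d-diameter at least ℓL, and σ ∈ {0,1}^E is such that Σ(σ) = {x∈E: σ(x)=1} separates A_1 and A_2 in B(x_*, 5ℓL). Suppose x_1,…,x_M is a sequence in E such that: (i) B(x_i, 5L) ⊆ B(x_*, 5ℓL) for 1 ≤ i ≤ M; (ii) d(x_i, x_{i+1}) ≤ L for 1 ≤ i < M; (iii) A_1 ∩ B(x_1, 2L) ≠ ∅ and A_2 ∩ B(x_M, 2L) ≠ ∅. Then σ ∈ S_{x_i, L} for some i ∈ {1,…,M}. -/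

import Mathlib

open MeasureTheory Filter Set
open scoped ENNReal NNReal Topology Classical

noncomputable section

/-- The weighted graph `G`: an infinite connected graph of bounded degree, with a weight
`ρG` which is uniformly bounded and uniformly positive on edges, `α`-Ahlfors regular. -/
structure GraphSetup where
  V : Type
  infV : Infinite V
  adjG : V → V → Prop
  adjG_symm : ∀ {y y'}, adjG y y' → adjG y' y
  adjG_irrefl : ∀ y, ¬adjG y y
  /-- `dG` is the graph distance on `G`; this characterization also encodes connectedness. -/
  dG : V → V → ℕ
  dG_spec : ∀ (y y' : V) (n : ℕ), dG y y' ≤ n ↔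
    ∃ p : ℕ → V, p 0 = y ∧ p n = y' ∧ ∀ i < n, p i = p (i + 1) ∨ adjG (p i) (p (i + 1))
  ballG_fin : ∀ (y : V) (R : ℝ), {y' | (dG y y' : ℝ) ≤ R}.Finite
  degBound : ℕ
  deg_fin : ∀ y : V, {y' | adjG y y'}.Finite
  deg_le : ∀ y : V, Nat.card {y' // adjG y y'} ≤ degBound
  ρG : V → V → ℝ
  ρG_symm : ∀ y y', ρG y y' = ρG y' y
  ρG_nonneg : ∀ y y', 0 ≤ ρG y y'
  ρG_pos_iff : ∀ y y', 0 < ρG y y' ↔ adjG y y'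
  ρG_lbd : ℝ
  ρG_ubd : ℝ
  ρG_lbd_pos : 0 < ρG_lbd
  ρG_bounds : ∀ y y', adjG y y' → ρG_lbd ≤ ρG y y' ∧ ρG y y' ≤ ρG_ubd
  α : ℝ
  β : ℝ
  α_gt_one : 1 < α
  β_ge_two : 2 ≤ β
  β_le_α_add_one : β ≤ α + 1
  cA : ℝ
  cA' : ℝ
  cA_pos : 0 < cA
  /-- `α`-Ahlfors regularity of `(G, ρG)`, lower bound. -/
  ahlfors_lb : ∀ (y : V) (R : ℝ), 1 / 2 ≤ R →
    cA * R ^ α ≤ ∑ y' ∈ (ballG_fin y R).toFinset, ∑' y'', ρG y' y''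
  /-- `α`-Ahlfors regularity of `(G, ρG)`, upper bound. -/
  ahlfors_ub : ∀ (y : V) (R : ℝ), 1 / 2 ≤ R →
    (∑ y' ∈ (ballG_fin y R).toFinset, ∑' y'', ρG y' y'') ≤ cA' * R ^ α

namespace GraphSetup

/-- The product graph `E = G × ℤ`. -/
abbrev E (S : GraphSetup) : Type := S.V × ℤ

instance (S : GraphSetup) : MeasurableSpace S.V := ⊤

/-- The exponent `ν = α - β/2`. -/
def ν (S : GraphSetup) : ℝ := S.α - S.β / 2

/-- Adjacency on `E = G × ℤ`. -/
def adjE (S : GraphSetup) (x x' : S.E) : Prop :=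
  (x.2 = x'.2 ∧ S.adjG x.1 x'.1) ∨ (x.1 = x'.1 ∧ (x.2 - x'.2).natAbs = 1)

/-- The weight on `E`: `ρG` on horizontal edges, `1` on vertical edges. -/
def ρE (S : GraphSetup) (x x' : S.E) : ℝ :=
  if x.2 = x'.2 then S.ρG x.1 x'.1
  else if x.1 = x'.1 ∧ (x.2 - x'.2).natAbs = 1 then 1 else 0

/-- `ρ(x) = Σ_{x' ~ x} ρ_{x,x'}`. -/
def ρEpt (S : GraphSetup) (x : S.E) : ℝ := ∑' x', S.ρE x x'

/-- Transition probability of the walk on `E`. -/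
def ptrans (S : GraphSetup) (x x' : S.E) : ℝ := S.ρE x x' / S.ρEpt x

/-- The metric `d((y,z),(y',z')) = max (d_G(y,y'), |z - z'|^{2/β})` on `E`. -/
def dE (S : GraphSetup) (x x' : S.E) : ℝ :=
  max (S.dG x.1 x'.1 : ℝ) (|(x.2 : ℝ) - (x'.2 : ℝ)| ^ (2 / S.β))

/-- Closed `d`-ball in `E`. -/
def ball (S : GraphSetup) (x : S.E) (r : ℝ) : Set S.E := {x' | S.dE x x' ≤ r}

/-- Vertex boundary `∂U`. -/
def vBoundary (S : GraphSetup) (U : Set S.E) : Set S.E :=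
  {x | x ∉ U ∧ ∃ x' ∈ U, S.adjE x x'}

/-- Closure `U ∪ ∂U`. -/
def cl (S : GraphSetup) (U : Set S.E) : Set S.E := U ∪ S.vBoundary U

/-- Interior vertex boundary `∂_int U`. -/
def intBoundary (S : GraphSetup) (U : Set S.E) : Set S.E :=
  {x | x ∈ U ∧ ∃ x', x' ∉ U ∧ S.adjE x x'}

/-- A nearest-neighbour path of length `n` contained in `A`. -/
def IsPathIn (S : GraphSetup) (A : Set S.E) (p : ℕ → S.E) (n : ℕ) : Prop :=
  (∀ i ≤ n, p i ∈ A) ∧ ∀ i < n, S.adjE (p i) (p (i + 1))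

/-- `B₁` is connected to `B₂` by a nearest-neighbour path contained in `A`. -/
def ConnectsIn (S : GraphSetup) (A B₁ B₂ : Set S.E) : Prop :=
  ∃ (n : ℕ) (p : ℕ → S.E), S.IsPathIn A p n ∧ p 0 ∈ B₁ ∧ p n ∈ B₂

/-- The connected component of `x` inside `A`. -/
def component (S : GraphSetup) (A : Set S.E) (x : S.E) : Set S.E :=
  {x' | S.ConnectsIn A {x} {x'}}

/-- `A` is a connected subset of `E`. -/
def IsConnectedSet (S : GraphSetup) (A : Set S.E) : Prop :=
  ∀ x ∈ A, ∀ x' ∈ A, S.ConnectsIn A {x} {x'}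

/-- `C` separates `A` and `B` in `U`: the graph distance between `A` and `B` exceeds `1`
and every nearest-neighbour path from `∂A` to `∂B` remaining in `U` meets `C`. -/
def Separates (S : GraphSetup) (A B C U : Set S.E) : Prop :=
  (∀ a ∈ A, ∀ b ∈ B, a ≠ b ∧ ¬S.adjE a b) ∧
  ∀ (n : ℕ) (p : ℕ → S.E), (∀ i ≤ n, p i ∈ U) → (∀ i < n, S.adjE (p i) (p (i + 1))) →
    p 0 ∈ S.vBoundary A → p n ∈ S.vBoundary B → ∃ i ≤ n, p i ∈ C

/-- The separation event `S_{x,L}`. -/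
def sepEvent (S : GraphSetup) (x : S.E) (L : ℕ) : Set (Set S.E) :=
  {C | ∃ A₁ A₂ : Set S.E,
    A₁ ⊆ S.cl (S.ball x (3 * L)) ∧ A₂ ⊆ S.cl (S.ball x (3 * L)) ∧
    S.IsConnectedSet A₁ ∧ S.IsConnectedSet A₂ ∧
    (∃ a ∈ A₁, ∃ a' ∈ A₁, (L : ℝ) ≤ S.dE a a') ∧
    (∃ a ∈ A₂, ∃ a' ∈ A₂, (L : ℝ) ≤ S.dE a a') ∧
    S.Separates A₁ A₂ C (S.ball x (5 * L))}

/-- A half-plane of `E = G × ℤ`: the product of a semi-infinite geodesic in `G` with `ℤ`. -/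
structure HalfPlane (S : GraphSetup) where
  ray : ℕ → S.V
  geodesic : ∀ n m : ℕ, S.dG (ray n) (ray m) = Nat.dist n m

/-- The set of points of a half-plane. -/
def HalfPlane.carrier {S : GraphSetup} (P : S.HalfPlane) : Set S.E :=
  {x | ∃ n, x.1 = P.ray n}

/-- `B₁` is connected to `B₂` by a `*`-path contained in `A ∩ 𝒫`. -/
def StarConnectsIn (S : GraphSetup) (P : S.HalfPlane) (A B₁ B₂ : Set S.E) : Prop :=
  ∃ (n : ℕ) (p : ℕ → S.E),
    (∀ i ≤ n, p i ∈ A ∧ p i ∈ P.carrier) ∧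
    (∀ i < n, p i ≠ p (i + 1) ∧ S.dG (p i).1 (p (i + 1)).1 ≤ 1 ∧
      ((p i).2 - (p (i + 1)).2).natAbs ≤ 1) ∧
    p 0 ∈ B₁ ∧ p n ∈ B₂

/-- An increasing event on `{0,1}^E` (configurations identified with subsets of `E`). -/
def IncreasingEvent (S : GraphSetup) (A : Set (Set S.E)) : Prop :=
  ∀ C C' : Set S.E, C ⊆ C' → C ∈ A → C' ∈ A

/-- A decreasing event on `{0,1}^E`. -/
def DecreasingEvent (S : GraphSetup) (A : Set (Set S.E)) : Prop :=
  ∀ C C' : Set S.E, C' ⊆ C → C ∈ A → C' ∈ A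

/-- The event `A` only depends on the coordinates in `B`. -/
def DependsOn (S : GraphSetup) (A : Set (Set S.E)) (B : Set S.E) : Prop :=
  ∀ C C' : Set S.E, C ∩ B = C' ∩ B → (C ∈ A ↔ C' ∈ A)

/-- The family `(G_{x,L})` cascades with complexity at most `lam`, with constant `c`. -/
def CascadesLe (S : GraphSetup) (Gf : S.E → ℕ → Set (Set S.E)) (lam c : ℝ) : Prop :=
  (∀ (x : S.E) (L : ℕ), 1 ≤ L → S.DependsOn (Gf x L) (S.ball x (10 * L))) ∧
  ∀ (ℓ : ℕ) (x : S.E) (L : ℕ), 1 ≤ L → 0 < ℓ → 100 ∣ ℓ →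
    ∃ Λ : Finset S.E, ↑Λ ⊆ S.ball x (9 * ℓ * L) ∧ (Λ.card : ℝ) ≤ c * (ℓ : ℝ) ^ lam ∧
      Gf x (ℓ * L) ⊆
        ⋃ x' ∈ Λ, ⋃ x'' ∈ Λ,
          ⋃ (_ : ((ℓ * L : ℕ) : ℝ) / 100 ≤ S.dE x' x''), Gf x' L ∩ Gf x'' L

/-- The length scales `L_n = ℓ₀ⁿ L₀`. -/
def Lscale (ℓ₀ L₀ n : ℕ) : ℕ := ℓ₀ ^ n * L₀

/-- Membership in `Λ_n`: an embedding of the dyadic tree of depth `n` in `E`,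
with nested balls and spread-out children. -/
def IsTreeEmbed (S : GraphSetup) (ℓ₀ L₀ n : ℕ) (T : ∀ k : ℕ, (Fin k → Bool) → S.E) : Prop :=
  ∀ k < n, ∀ (m : Fin k → Bool) (b : Bool),
    S.ball (T (k + 1) (Fin.snoc m b)) (10 * Lscale ℓ₀ L₀ (n - (k + 1))) ⊆
        S.ball (T k m) (10 * Lscale ℓ₀ L₀ (n - k)) ∧
      ((Lscale ℓ₀ L₀ (n - k) : ℝ)) / 100 ≤
        S.dE (T (k + 1) (Fin.snoc m false)) (T (k + 1) (Fin.snoc m true))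

/-- The factor `1 + c₁ √K (k+1)^{-3/2} ℓ₀^{-(ν-ν')/2}`. -/
def decFactor (c₁ K νv ν' : ℝ) (ℓ₀ : ℕ) (k : ℕ) : ℝ :=
  1 + c₁ * Real.sqrt K * ((k : ℝ) + 1) ^ (-(3 : ℝ) / 2) * (ℓ₀ : ℝ) ^ (-(νv - ν') / 2)

/-- The increasing sequence of levels `u_n⁺`. -/
def uPlusSeq (c₁ K νv ν' : ℝ) (ℓ₀ : ℕ) (u₀ : ℝ) (n : ℕ) : ℝ :=
  (∏ k ∈ Finset.range n, decFactor c₁ K νv ν' ℓ₀ k) * u₀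

/-- The decreasing sequence of levels `u_n⁻`. -/
def uMinusSeq (c₁ K νv ν' : ℝ) (ℓ₀ : ℕ) (u₀ : ℝ) (n : ℕ) : ℝ :=
  (∏ k ∈ Finset.range n, (decFactor c₁ K νv ν' ℓ₀ k)⁻¹) * u₀

/-- The limit `u_∞⁺` of `u_n⁺`. -/
def uPlusInf (c₁ K νv ν' : ℝ) (ℓ₀ : ℕ) (u₀ : ℝ) : ℝ := ⨆ n, uPlusSeq c₁ K νv ν' ℓ₀ u₀ n

/-- The limit `u_∞⁻` of `u_n⁻`. -/
def uMinusInf (c₁ K νv ν' : ℝ) (ℓ₀ : ℕ) (u₀ : ℝ) : ℝ := ⨅ n, uMinusSeq c₁ K νv ν' ℓ₀ u₀ n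

/-- The error term `ε(u) = 2 e^{-K u L₀^ν ℓ₀^{ν'}} / (1 - e^{-K u L₀^ν ℓ₀^{ν'}})`. -/
def epsDecouple (K u : ℝ) (L₀ ℓ₀ : ℕ) (νv ν' : ℝ) : ℝ :=
  2 * Real.exp (-(K * u * (L₀ : ℝ) ^ νv * (ℓ₀ : ℝ) ^ ν')) /
    (1 - Real.exp (-(K * u * (L₀ : ℝ) ^ νv * (ℓ₀ : ℝ) ^ ν')))

/-- The canonical law of the random walk on `E`, as a family of measures on trajectories. -/
structure WalkLaw (S : GraphSetup) where
  P : S.E → Measure (ℕ → S.E)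
  isProb : ∀ x, IsProbabilityMeasure (P x)
  cyl : ∀ (x : S.E) (n : ℕ) (q : ℕ → S.E), q 0 = x →
    P x {w | ∀ i ≤ n, w i = q i} =
      ENNReal.ofReal (∏ i ∈ Finset.range n, S.ptrans (q i) (q (i + 1)))
  cyl0 : ∀ (x : S.E) (q : ℕ → S.E), q 0 ≠ x → P x {w | w 0 = q 0} = 0

instance {S : GraphSetup} (W : WalkLaw S) (x : S.E) : IsProbabilityMeasure (W.P x) :=
  W.isProb x

namespace WalkLaw

variable {S : GraphSetup}

/-- `P_x[H_K < ∞]`, the probability to ever enter `K`. -/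
def hitProb (W : WalkLaw S) (x : S.E) (K : Set S.E) : ℝ≥0∞ := W.P x {w | ∃ n, w n ∈ K}

/-- `P_x[H̃_K = ∞]`, the probability never to hit `K` at a positive time. -/
def escProb (W : WalkLaw S) (x : S.E) (K : Set S.E) : ℝ≥0∞ :=
  W.P x {w | ∀ n, 1 ≤ n → w n ∉ K}

/-- `P_x[H_K < ∞, X_{H_K} = x']`, the probability to enter `K` for the first time at `x'`. -/
def entersAt (W : WalkLaw S) (x : S.E) (K : Set S.E) (x' : S.E) : ℝ≥0∞ :=
  W.P x {w | ∃ n, w n = x' ∧ ∀ m < n, w m ∉ K}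

/-- The equilibrium measure `e_K`. -/
def equilibrium (W : WalkLaw S) (K : Set S.E) (x : S.E) : ℝ :=
  if x ∈ K then (W.escProb x K).toReal * S.ρEpt x else 0

/-- The capacity `cap(K) = Σ_{x ∈ K} P_x[H̃_K = ∞] ρ(x)`. -/
def capacity (W : WalkLaw S) (K : Set S.E) : ℝ :=
  ∑' x : K, (W.escProb x.1 K).toReal * S.ρEpt x.1

/-- The Green density `g(x,x') = Σ_{n ≥ 0} P_x[X_n = x'] / ρ(x')`. -/
def green (W : WalkLaw S) (x x' : S.E) : ℝ :=
  (∑' n : ℕ, (W.P x {w | w n = x'}).toReal) / S.ρEpt x'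

/-- The standing assumption `c (d(x,x') ∨ 1)^{-ν} ≤ g(x,x') ≤ c' (d(x,x') ∨ 1)^{-ν}`. -/
def GreenBounds (W : WalkLaw S) (cg cg' : ℝ) : Prop :=
  0 < cg ∧ cg ≤ cg' ∧ ∀ x x' : S.E,
    cg * (max (S.dE x x') 1) ^ (-S.ν) ≤ W.green x x' ∧
      W.green x x' ≤ cg' * (max (S.dE x x') 1) ^ (-S.ν)

end WalkLaw

/-- Random interlacements on `E`, encoded by their canonical probability space and the
family of interlacement sets `ℐ^u`, `u ≥ 0`, with
`ℙ[𝒱^u ⊇ K] = exp(-u cap(K))` for all finite `K`. -/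
structure Interlacement (S : GraphSetup) (W : WalkLaw S) where
  Ω : Type
  mΩ : MeasurableSpace Ω
  prob : @Measure Ω mΩ
  isProb : IsProbabilityMeasure prob
  I : ℝ → Ω → Set S.E
  I_mono : ∀ u u' : ℝ, u ≤ u' → ∀ ω, I u ω ⊆ I u' ω
  vacant_law : ∀ u : ℝ, 0 ≤ u → ∀ K : Set S.E, K.Finite →
    prob {ω | Disjoint K (I u ω)} = ENNReal.ofReal (Real.exp (-(u * W.capacity K)))

namespace Interlacement

variable {S : GraphSetup} {W : WalkLaw S}

/-- The vacant set `𝒱^u = E ∖ ℐ^u`. -/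
def vacant (RI : Interlacement S W) (u : ℝ) (ω : RI.Ω) : Set S.E := (RI.I u ω)ᶜ

/-- The event that `x` lies in an infinite connected component of `𝒱^u`. -/
def percolates (RI : Interlacement S W) (x : S.E) (u : ℝ) : Set RI.Ω :=
  {ω | (S.component (RI.vacant u ω) x).Infinite}

/-- The one-arm event: `B(x,L)` is connected to `∂_int B(x,2L)` in `𝒱^u`. -/
def oneArm (RI : Interlacement S W) (x : S.E) (L : ℝ) (u : ℝ) : Set RI.Ω :=
  {ω | S.ConnectsIn (RI.vacant u ω) (S.ball x L) (S.intBoundary (S.ball x (2 * L)))}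

/-- `sup_{x ∈ E} ℙ[B(x,L) ↔ ∂_int B(x,2L) in 𝒱^u]`. -/
def oneArmSup (RI : Interlacement S W) (u : ℝ) (L : ℕ) : ℝ≥0∞ :=
  ⨆ x : S.E, RI.prob (RI.oneArm x L u)

/-- The set defining `u_*`. -/
def uStarSet (RI : Interlacement S W) : Set ℝ :=
  {u | 0 ≤ u ∧ ∀ x : S.E, RI.prob (RI.percolates x u) = 0}

/-- The critical level `u_*`. -/
def uStar (RI : Interlacement S W) : ℝ := sInf RI.uStarSet

/-- The set defining `u_**`. -/
def uStarStarSet (RI : Interlacement S W) : Set ℝ :=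
  {u | 0 ≤ u ∧ Filter.liminf (fun L : ℕ => RI.oneArmSup u L) Filter.atTop = 0}

/-- The critical level `u_**`. -/
def uStarStar (RI : Interlacement S W) : ℝ := sInf RI.uStarStarSet

/-- The `*`-crossing event for `ℐ^u` inside a half-plane. -/
def starCross (RI : Interlacement S W) (P : S.HalfPlane) (x : S.E) (L : ℝ) (u : ℝ) :
    Set RI.Ω :=
  {ω | S.StarConnectsIn P (RI.I u ω) (S.ball x L) (S.intBoundary (S.ball x (2 * L)))}

/-- `sup_{𝒫, x ∈ 𝒫} ℙ[B(x,L) ↔* ∂_int B(x,2L) in ℐ^u ∩ 𝒫]`. -/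
def starSup (RI : Interlacement S W) (u : ℝ) (L : ℕ) : ℝ≥0∞ :=
  ⨆ P : S.HalfPlane, ⨆ x : P.carrier, RI.prob (RI.starCross P x.1 L u)

/-- The set defining `ũ`. -/
def uTildeSet (RI : Interlacement S W) : Set ℝ :=
  {u | 0 ≤ u ∧ 0 < Filter.liminf (fun L : ℕ => RI.starSup u L) Filter.atTop}

/-- The critical level `ũ`. -/
def uTilde (RI : Interlacement S W) : ℝ := sInf RI.uTildeSet

/-- For an event `A` on `{0,1}^E`, the event `A^u` that the indicator of `ℐ^u` lies in `A`. -/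
def eventAt (RI : Interlacement S W) (A : Set (Set S.E)) (u : ℝ) : Set RI.Ω :=
  {ω | RI.I u ω ∈ A}

end Interlacement

end GraphSetup

open GraphSetup

namespace GraphSetup

variable {S : GraphSetup}

lemma dG_self (S : GraphSetup) (y : S.V) : S.dG y y = 0 :=
  Nat.le_zero.mp ((S.dG_spec y y 0).2 ⟨fun _ => y, rfl, rfl, by simp⟩)

lemma dG_comm_le (S : GraphSetup) (y y' : S.V) : S.dG y' y ≤ S.dG y y' := by
  obtain ⟨p, h0, hn, hp⟩ := (S.dG_spec y y' _).1 le_rfl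
  refine (S.dG_spec _ _ _).2 ⟨fun i => p (S.dG y y' - i), by simpa using hn, by simpa using h0, ?_⟩
  intro i hi
  have h := hp (S.dG y y' - (i + 1)) (by omega)
  rw [show S.dG y y' - (i + 1) + 1 = S.dG y y' - i by omega] at h
  exact h.imp Eq.symm S.adjG_symm

lemma dG_comm (S : GraphSetup) (y y' : S.V) : S.dG y y' = S.dG y' y :=
  le_antisymm (S.dG_comm_le y' y) (S.dG_comm_le y y')

lemma dG_triangle (S : GraphSetup) (x y z : S.V) : S.dG x z ≤ S.dG x y + S.dG y z := by
  obtain ⟨p, hp0, hpn, hp⟩ := (S.dG_spec x y _).1 le_rfl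
  obtain ⟨q, hq0, hqn, hq⟩ := (S.dG_spec y z _).1 le_rfl
  refine (S.dG_spec _ _ _).2
    ⟨fun i => if i ≤ S.dG x y then p i else q (i - S.dG x y), by simpa using hp0, ?_, ?_⟩
  · dsimp only
    split_ifs with h
    · have h0 : S.dG y z = 0 := by omega
      rw [h0] at hqn
      rw [h0, add_zero, hpn, ← hq0, hqn]
    · simpa using hqn
  · intro i hi
    dsimp only
    rcases lt_trichotomy i (S.dG x y) with h | h | h
    · rw [if_pos h.le, if_pos (Nat.succ_le_of_lt h)]
      exact hp i h
    · rw [if_pos h.le, if_neg (by omega), h, hpn, ← hq0, Nat.add_sub_cancel_left]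
      exact hq 0 (by omega)
    · rw [if_neg (by omega), if_neg (by omega), Nat.sub_add_comm h.le]
      exact hq _ (by omega)

lemma dG_adj_le {y y' : S.V} (h : S.adjG y y') : S.dG y y' ≤ 1 :=
  (S.dG_spec y y' 1).2 ⟨fun i => if i = 0 then y else y', rfl, rfl, by simp [h]⟩

/-- Every vertex of `G` is the start of geodesic segments of arbitrary length. -/
lemma exists_geodesic (S : GraphSetup) (y : S.V) (n : ℕ) :
    ∃ p : ℕ → S.V, p 0 = y ∧ (∀ i < n, p i = p (i + 1) ∨ S.adjG (p i) (p (i + 1))) ∧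
      (∀ i ≤ n, S.dG y (p i) ≤ i) ∧ n ≤ S.dG y (p n) := by
  have := S.infV
  obtain ⟨y', hy'⟩ := (S.ballG_fin y n).infinite_compl.nonempty
  have hlt : n < S.dG y y' := by simpa using hy'
  obtain ⟨p, h0, hN, hp⟩ := (S.dG_spec y y' _).1 le_rfl
  refine ⟨p, h0, fun i hi => hp i (hi.trans hlt), fun i hi => ?_, ?_⟩
  · exact (S.dG_spec _ _ _).2 ⟨p, h0, rfl, fun j hj => hp j (by omega)⟩
  · have h1 : S.dG (p n) y' ≤ S.dG y y' - n := by
      refine (S.dG_spec _ _ _).2 ⟨fun i => p (n + i), rfl, ?_, fun i hi => hp _ (by omega)⟩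
      dsimp only
      rw [Nat.add_sub_cancel' hlt.le, hN]
    have h2 := S.dG_triangle y (p n) y'
    omega

lemma two_div_β_nonneg (S : GraphSetup) : 0 ≤ 2 / S.β :=
  div_nonneg zero_le_two (zero_le_two.trans S.β_ge_two)

lemma two_div_β_le_one (S : GraphSetup) : 2 / S.β ≤ 1 :=
  div_le_one_of_le₀ S.β_ge_two (zero_le_two.trans S.β_ge_two)

lemma two_div_β_pos (S : GraphSetup) : 0 < 2 / S.β :=
  div_pos zero_lt_two (zero_lt_two.trans_le S.β_ge_two)

lemma dE_comm (S : GraphSetup) (x y : S.E) : S.dE x y = S.dE y x := by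
  unfold dE
  rw [S.dG_comm, abs_sub_comm]

lemma dE_triangle (S : GraphSetup) (x y z : S.E) : S.dE x z ≤ S.dE x y + S.dE y z := by
  refine max_le ?_ ?_
  · calc (S.dG x.1 z.1 : ℝ) ≤ S.dG x.1 y.1 + S.dG y.1 z.1 := mod_cast S.dG_triangle _ _ _
      _ ≤ _ := add_le_add (le_max_left _ _) (le_max_left _ _)
  · calc |(x.2 : ℝ) - z.2| ^ (2 / S.β)
        ≤ (|(x.2 : ℝ) - y.2| + |(y.2 : ℝ) - z.2|) ^ (2 / S.β) :=
          Real.rpow_le_rpow (abs_nonneg _) (abs_sub_le _ _ _) S.two_div_β_nonneg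
      _ ≤ |(x.2 : ℝ) - y.2| ^ (2 / S.β) + |(y.2 : ℝ) - z.2| ^ (2 / S.β) :=
          Real.rpow_add_le_add_rpow (abs_nonneg _) (abs_nonneg _) S.two_div_β_nonneg
            S.two_div_β_le_one
      _ ≤ _ := add_le_add (le_max_right _ _) (le_max_right _ _)

lemma dE_of_snd_eq {x y : S.E} (h : x.2 = y.2) : S.dE x y = S.dG x.1 y.1 := by
  unfold dE
  rw [h, sub_self, abs_zero, Real.zero_rpow S.two_div_β_pos.ne']
  exact max_eq_left (Nat.cast_nonneg _)

lemma adjE_symm {x y : S.E} (h : S.adjE x y) : S.adjE y x :=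
  h.imp (fun h => ⟨h.1.symm, S.adjG_symm h.2⟩) fun h => ⟨h.1.symm, by have := h.2; omega⟩

lemma dE_adj_le {x y : S.E} (h : S.adjE x y) : S.dE x y ≤ 1 := by
  rcases h with h | h
  · rw [dE_of_snd_eq h.1]
    exact mod_cast dG_adj_le h.2
  · have h1 : |(x.2 : ℝ) - y.2| = 1 := by
      rw [← Int.cast_sub, ← Int.cast_abs, Int.abs_eq_natAbs, h.2]
      simp
    unfold dE
    rw [h.1, S.dG_self, h1, Real.one_rpow]
    simp

/-- Adjacency within a set `A`. -/
def adjIn (S : GraphSetup) (A : Set S.E) (x y : S.E) : Prop := x ∈ A ∧ y ∈ A ∧ S.adjE x y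

lemma adjIn_symm {A : Set S.E} {x y : S.E} (h : S.adjIn A x y) : S.adjIn A y x :=
  ⟨h.2.1, h.1, adjE_symm h.2.2⟩

lemma reflTransGen_adjIn_symm {A : Set S.E} {x y : S.E}
    (h : Relation.ReflTransGen (S.adjIn A) x y) : Relation.ReflTransGen (S.adjIn A) y x := by
  induction h with
  | refl => exact .refl
  | tail _ h ih => exact .head (adjIn_symm h) ih

lemma reflTransGen_adjIn_of_path {A : Set S.E} {p : ℕ → S.E} {n : ℕ} (hA : ∀ i ≤ n, p i ∈ A)
    (hp : ∀ i < n, p i = p (i + 1) ∨ S.adjE (p i) (p (i + 1))) :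
    ∀ i ≤ n, Relation.ReflTransGen (S.adjIn A) (p 0) (p i) := by
  intro i
  induction i with
  | zero => exact fun _ => .refl
  | succ i ih =>
    intro hi
    have h := ih (by omega)
    rcases hp i hi with heq | hadj
    · exact heq ▸ h
    · exact h.tail ⟨hA i (by omega), hA _ hi, hadj⟩

/-- Extend a path by one final vertex. -/
lemma IsPathIn.snoc {A : Set S.E} {p : ℕ → S.E} {n : ℕ} (hp : S.IsPathIn A p n) {y : S.E}
    (hy : y ∈ A) (hadj : S.adjE (p n) y) :
    ∃ q : ℕ → S.E, S.IsPathIn A q (n + 1) ∧ q 0 = p 0 ∧ q (n + 1) = y := by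
  refine ⟨fun i => if i ≤ n then p i else y, ⟨fun i hi => ?_, fun i hi => ?_⟩, by simp, by simp⟩
  · dsimp only
    split_ifs with h
    exacts [hp.1 i h, hy]
  · dsimp only
    rcases Nat.lt_succ_iff_lt_or_eq.mp hi with h | rfl
    · rw [if_pos h.le, if_pos (Nat.succ_le_of_lt h)]
      exact hp.2 i h
    · simpa using hadj

lemma connectsIn_of_reflTransGen {A : Set S.E} {x y : S.E} (hx : x ∈ A)
    (h : Relation.ReflTransGen (S.adjIn A) x y) : S.ConnectsIn A {x} {y} := by
  induction h with
  | refl => exact ⟨0, fun _ => x, ⟨fun _ _ => hx, by simp⟩, rfl, rfl⟩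
  | tail _ h ih =>
    obtain ⟨n, p, hp, h0, hn⟩ := ih
    obtain ⟨q, hq, hq0, hqn⟩ := hp.snoc h.2.1 (hn ▸ h.2.2)
    exact ⟨n + 1, q, hq, hq0.trans h0, hqn⟩

lemma ConnectsIn.reflTransGen {A : Set S.E} {x y : S.E} (h : S.ConnectsIn A {x} {y}) :
    Relation.ReflTransGen (S.adjIn A) x y := by
  obtain ⟨n, p, hp, h0, hn⟩ := h
  rw [← h0, ← hn]
  exact reflTransGen_adjIn_of_path hp.1 (fun i hi => .inr (hp.2 i hi)) n le_rfl

/-- The set of vertices of a lazy nearest-neighbour path is connected. -/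
lemma isConnectedSet_path {p : ℕ → S.E} {n : ℕ}
    (hp : ∀ i < n, p i = p (i + 1) ∨ S.adjE (p i) (p (i + 1))) :
    S.IsConnectedSet (p '' {i | i ≤ n}) := by
  have h := reflTransGen_adjIn_of_path (fun i hi => mem_image_of_mem p hi) hp
  rintro _ ⟨i, hi, rfl⟩ _ ⟨j, hj, rfl⟩
  exact connectsIn_of_reflTransGen (mem_image_of_mem p hi)
    ((reflTransGen_adjIn_symm (h i hi)).trans (h j hj))

/-- A connected set of diameter at least `ℓL` with `ℓ ≥ 100` that meets `B(x,2L)` has a connected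
piece in the closure of `B(x,3L)` of diameter at least `L`. -/
lemma exists_connected_piece {K : Set S.E} (hK : S.IsConnectedSet K) {L : ℕ} (hL : 1 ≤ L)
    {a a' : S.E} (ha : a ∈ K) (ha' : a' ∈ K) (hd : (100 * L : ℝ) ≤ S.dE a a') {x : S.E}
    (hx : (K ∩ S.ball x (2 * L)).Nonempty) :
    ∃ K' ⊆ K, K' ⊆ S.cl (S.ball x (3 * L)) ∧ S.IsConnectedSet K' ∧
      ∃ b ∈ K', ∃ b' ∈ K', (L : ℝ) ≤ S.dE b b' := by
  have hL' : (1 : ℝ) ≤ L := mod_cast hL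
  obtain ⟨k, hkK, hk⟩ := hx
  have hk : S.dE x k ≤ 2 * L := hk
  obtain ⟨k', hk'K, hk'⟩ : ∃ k' ∈ K, k' ∉ S.ball x (3 * L) := by
    by_contra! h
    have h1 : S.dE x a ≤ 3 * L := h a ha
    have h2 : S.dE x a' ≤ 3 * L := h a' ha'
    have h3 := S.dE_triangle a x a'
    rw [S.dE_comm a x] at h3
    linarith
  obtain ⟨n, p, hp, h0, hn⟩ := hK k hkK k' hk'K
  rw [mem_singleton_iff] at h0 hn
  have hex : ∃ m, m ≤ n ∧ p m ∉ S.ball x (3 * L) := ⟨n, le_rfl, hn ▸ hk'⟩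
  obtain ⟨hmn, hm⟩ := Nat.find_spec hex
  have hmin : ∀ j < Nat.find hex, p j ∈ S.ball x (3 * L) := fun j hj => by
    by_contra h
    exact Nat.find_min hex hj ⟨by omega, h⟩
  generalize Nat.find hex = m at hmn hm hmin
  have hk3 : p 0 ∈ S.ball x (3 * L) := by
    rw [h0]
    show S.dE x k ≤ 3 * L
    linarith
  have hm0 : m ≠ 0 := by
    rintro rfl
    exact hm hk3
  refine ⟨p '' {i | i ≤ m}, ?_, ?_, isConnectedSet_path fun i hi => .inr (hp.2 i (by omega)),
    p 0, ⟨0, Nat.zero_le _, rfl⟩, p m, ⟨m, le_refl m, rfl⟩, ?_⟩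
  · rintro _ ⟨i, hi, rfl⟩
    exact hp.1 i (le_trans hi hmn)
  · rintro _ ⟨i, hi, rfl⟩
    rcases (show i ≤ m from hi).lt_or_eq with h | rfl
    · exact .inl (hmin i h)
    · refine .inr ⟨hm, p (i - 1), hmin _ (by omega), ?_⟩
      have h := hp.2 (i - 1) (by omega)
      rw [Nat.sub_add_cancel (by omega)] at h
      exact adjE_symm h
  · have h1 : 3 * (L : ℝ) < S.dE x (p m) := not_le.mp hm
    have h2 := S.dE_triangle x (p 0) (p m)
    rw [h0] at h2 ⊢
    linarith

/-- The ball `B(x,L)` contains a connected set of diameter at least `L`. -/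
lemma exists_connected_in_ball (S : GraphSetup) (x : S.E) (L : ℕ) :
    ∃ B ⊆ S.ball x L, S.IsConnectedSet B ∧ ∃ b ∈ B, ∃ b' ∈ B, (L : ℝ) ≤ S.dE b b' := by
  obtain ⟨p, h0, hp, hle, hge⟩ := S.exists_geodesic x.1 L
  refine ⟨(fun i => (p i, x.2)) '' {i | i ≤ L}, ?_, isConnectedSet_path fun i hi => ?_,
    (p 0, x.2), ⟨0, Nat.zero_le _, rfl⟩, (p L, x.2), ⟨L, le_refl L, rfl⟩, ?_⟩
  · rintro _ ⟨i, hi, rfl⟩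
    show S.dE x (p i, x.2) ≤ L
    rw [dE_of_snd_eq (show x.2 = (p i, x.2).2 from rfl)]
    exact mod_cast (hle i hi).trans hi
  · exact (hp i hi).imp (fun h => by rw [h]) fun h => .inl ⟨rfl, h⟩
  · rw [dE_of_snd_eq (show (p 0, x.2).2 = (p L, x.2).2 from rfl)]
    simpa [h0] using hge

/-- The set of points reachable from `A` through `U`. -/
inductive Hull (S : GraphSetup) (A U : Set S.E) : S.E → Prop
  | base {a : S.E} : a ∈ A → Hull S A U a
  | step {a y : S.E} : Hull S A U a → S.adjE a y → y ∈ U → Hull S A U y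

lemma isConnectedSet_hull {A : Set S.E} (hA : S.IsConnectedSet A) (U : Set S.E) :
    S.IsConnectedSet {x | S.Hull A U x} := by
  have key : ∀ x, S.Hull A U x → ∃ a ∈ A,
      Relation.ReflTransGen (S.adjIn {x | S.Hull A U x}) a x := by
    intro x hx
    induction hx with
    | base h => exact ⟨_, h, .refl⟩
    | step ha hadj hy ih =>
      obtain ⟨b, hb, h⟩ := ih
      exact ⟨b, hb, h.tail ⟨ha, ha.step hadj hy, hadj⟩⟩
  intro x hx y hy
  obtain ⟨a, ha, hax⟩ := key x hx
  obtain ⟨b, hb, hby⟩ := key y hy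
  have hab : Relation.ReflTransGen (S.adjIn {x | S.Hull A U x}) a b :=
    Relation.ReflTransGen.mono (fun u v h => ⟨.base h.1, .base h.2.1, h.2.2⟩) _ _
      (hA a ha b hb).reflTransGen
  exact connectsIn_of_reflTransGen hx (((reflTransGen_adjIn_symm hax).trans hab).trans hby)

/-- If `C` separates `A` and `B` in `U`, then the points reachable from `A` through `U \ C`
are at graph distance greater than `1` from `B`. -/
lemma Separates.hull_far {A B C U : Set S.E} (h : S.Separates A B C U) {x : S.E}
    (hx : S.Hull A (U \ C) x) : ∀ b ∈ B, x ≠ b ∧ ¬S.adjE x b := by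
  have hpath : ∀ (n : ℕ) (p : ℕ → S.E), S.IsPathIn (U \ C) p n → p 0 ∈ S.vBoundary A →
      p n ∉ S.vBoundary B := by
    intro n p hp h0 hn
    obtain ⟨i, hi, hC⟩ := h.2 n p (fun i hi => (hp.1 i hi).1) hp.2 h0 hn
    exact (hp.1 i hi).2 hC
  have key : x ∈ A ∨ (x ∉ B ∧ ∃ (n : ℕ) (p : ℕ → S.E),
      S.IsPathIn (U \ C) p n ∧ p 0 ∈ S.vBoundary A ∧ p n = x) := by
    induction hx with
    | base ha => exact .inl ha
    | @step a y _ hadj hy ih =>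
      by_cases hyA : y ∈ A
      · exact .inl hyA
      refine .inr ?_
      rcases ih with ha | ⟨haB, n, p, hp, h0, hn⟩
      · exact ⟨fun hyB => (h.1 a ha y hyB).2 hadj, 0, fun _ => y,
          ⟨fun _ _ => hy, by simp⟩, ⟨hyA, a, ha, adjE_symm hadj⟩, rfl⟩
      · refine ⟨fun hyB => hpath n p hp h0 (hn ▸ ⟨haB, y, hyB, hadj⟩), ?_⟩
        obtain ⟨q, hq, hq0, hqn⟩ := hp.snoc hy (hn ▸ hadj)
        exact ⟨n + 1, q, hq, hq0 ▸ h0, hqn⟩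
  intro b hb
  rcases key with hxA | ⟨hxB, n, p, hp, h0, hn⟩
  · exact h.1 x hxA b hb
  · exact ⟨fun he => hxB (he ▸ hb), fun hadj => hpath n p hp h0 (hn ▸ ⟨hxB, b, hb, hadj⟩)⟩

/-- A subset of the points reachable from `A` through `U \ C` is separated by `C` from any set at
graph distance greater than `1` from all these points. -/
lemma separates_of_hull {A C U V K B : Set S.E} (hK : K ⊆ {x | S.Hull A (U \ C) x}) (hV : V ⊆ U)
    (hB : ∀ x, S.Hull A (U \ C) x → ∀ b ∈ B, x ≠ b ∧ ¬S.adjE x b) : S.Separates K B C V := by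
  refine ⟨fun a ha => hB a (hK ha), fun n p hpV hp h0 hn => ?_⟩
  by_contra! hC
  have hmem : ∀ i ≤ n, p i ∈ U \ C := fun i hi => ⟨hV (hpV i hi), hC i hi⟩
  have hull : ∀ i ≤ n, S.Hull A (U \ C) (p i) := by
    intro i
    induction i with
    | zero =>
      intro hi
      obtain ⟨-, a, ha, hadj⟩ := h0
      exact .step (hK ha) (adjE_symm hadj) (hmem 0 hi)
    | succ i ih => exact fun hi => .step (ih (by omega)) (hp i hi) (hmem _ hi)
  obtain ⟨-, b, hb, hadj⟩ := hn
  exact (hB _ (hull n le_rfl) b hb).2 hadj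

end GraphSetup

/-- Lemma A.1: if `A₁, A₂` are connected subsets of the closure of `B(x_*, 3ℓL)` of
`d`-diameter at least `ℓL` separated by `Σ(σ)` in `B(x_*, 5ℓL)`, and `x_1, …, x_M` is a
chain of points with `B(x_i,5L) ⊆ B(x_*,5ℓL)`, consecutive distances at most `L`, whose
first (resp. last) `2L`-ball meets `A₁` (resp. `A₂`), then `σ` lies in some separation event
`S_{x_i,L}`. -/
theorem stmt18 (S : GraphSetup) (W : WalkLaw S) (cg cg' : ℝ) (hG : W.GreenBounds cg cg') :
    ∀ (ℓ L : ℕ) (xstar : S.E), 100 ∣ ℓ → 0 < ℓ → 1 ≤ L →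
    ∀ A₁ A₂ : Set S.E,
      A₁ ⊆ S.cl (S.ball xstar (3 * (ℓ * L))) → A₂ ⊆ S.cl (S.ball xstar (3 * (ℓ * L))) →
      S.IsConnectedSet A₁ → S.IsConnectedSet A₂ →
      (∃ a ∈ A₁, ∃ a' ∈ A₁, ((ℓ * L : ℕ) : ℝ) ≤ S.dE a a') →
      (∃ a ∈ A₂, ∃ a' ∈ A₂, ((ℓ * L : ℕ) : ℝ) ≤ S.dE a a') →
    ∀ C : Set S.E, S.Separates A₁ A₂ C (S.ball xstar (5 * (ℓ * L))) →
    ∀ (M : ℕ) (xs : ℕ → S.E), 1 ≤ M →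
      (∀ i < M, S.ball (xs i) (5 * L) ⊆ S.ball xstar (5 * (ℓ * L))) →
      (∀ i, i + 1 < M → S.dE (xs i) (xs (i + 1)) ≤ L) →
      (A₁ ∩ S.ball (xs 0) (2 * L)).Nonempty →
      (A₂ ∩ S.ball (xs (M - 1)) (2 * L)).Nonempty →
      ∃ i < M, C ∈ S.sepEvent (xs i) L := by
  intro ℓ L xstar hℓ hℓ0 hL A₁ A₂ _ _ hc₁ hc₂ hd₁ hd₂ C hC M xs hM hball hstep hfst hlast
  have hL' : (1 : ℝ) ≤ L := mod_cast hL
  have hℓL : (100 * L : ℝ) ≤ (ℓ * L : ℕ) :=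
    mod_cast Nat.mul_le_mul_right L (Nat.le_of_dvd hℓ0 hℓ)
  obtain ⟨a₁, ha₁, a₁', ha₁', had₁⟩ := hd₁
  obtain ⟨a₂, ha₂, a₂', ha₂', had₂⟩ := hd₂
  set U := S.ball xstar (5 * (ℓ * L))
  set K : Set S.E := {x | S.Hull A₁ (U \ C) x}
  have hK : S.IsConnectedSet K := isConnectedSet_hull hc₁ _
  have piece : ∀ x, (K ∩ S.ball x (2 * L)).Nonempty → _ := fun x =>
    exists_connected_piece (x := x) hK hL (.base ha₁) (.base ha₁') (hℓL.trans had₁)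
  by_cases hend : (K ∩ S.ball (xs (M - 1)) (2 * L)).Nonempty
  · obtain ⟨K₁, hK₁, hcl₁, hcon₁, hdiam₁⟩ := piece _ hend
    obtain ⟨K₂, hK₂, hcl₂, hcon₂, hdiam₂⟩ :=
      exists_connected_piece hc₂ hL ha₂ ha₂' (hℓL.trans had₂) hlast
    exact ⟨M - 1, by omega, K₁, K₂, hcl₁, hcl₂, hcon₁, hcon₂, hdiam₁, hdiam₂,
      separates_of_hull hK₁ (hball _ (by omega)) fun x hx b hb => hC.hull_far hx b (hK₂ hb)⟩
  · obtain ⟨i, hi, hmeet, hmiss⟩ : ∃ i, i + 1 < M ∧ (K ∩ S.ball (xs i) (2 * L)).Nonempty ∧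
        ¬(K ∩ S.ball (xs (i + 1)) (2 * L)).Nonempty := by
      by_contra! h
      have hall : ∀ i < M, (K ∩ S.ball (xs i) (2 * L)).Nonempty := by
        intro i
        induction i with
        | zero => exact fun _ => hfst.mono (inter_subset_inter_left _ fun x hx => .base hx)
        | succ i ih =>
          exact fun hi => h i hi (ih (by omega))
      exact hend (hall _ (by omega))
    obtain ⟨K₁, hK₁, hcl₁, hcon₁, hdiam₁⟩ := piece _ hmeet
    obtain ⟨B, hB, hconB, hdiamB⟩ := S.exists_connected_in_ball (xs (i + 1)) L
    refine ⟨i, by omega, K₁, B, hcl₁, fun b hb => .inl ?_, hcon₁, hconB, hdiam₁, hdiamB,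
      separates_of_hull hK₁ (hball _ (by omega)) fun x hx b hb => ?_⟩
    · have h1 : S.dE (xs (i + 1)) b ≤ L := hB hb
      have h2 := S.dE_triangle (xs i) (xs (i + 1)) b
      have h3 := hstep i hi
      show S.dE (xs i) b ≤ 3 * L
      linarith
    · have h1 : S.dE (xs (i + 1)) b ≤ L := hB hb
      have far : ¬S.dE (xs (i + 1)) x ≤ 2 * L := fun h => hmiss ⟨x, hx, h⟩
      refine ⟨?_, fun hadj => far ?_⟩
      · rintro rfl
        exact far (by linarith)
      · have h2 := S.dE_triangle (xs (i + 1)) b x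
        have h3 := dE_adj_le (adjE_symm hadj)
        linarith
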